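/- Let D > 1 be a square-free integer with D ≡ 1 (mod 8), F = ℚ(√D), 𝒪 the ring of integers of F, and 𝔡 the different ideal of F/ℚ. Then there exist a totally positive β ∈ F^×, a prime ideal 𝔭 of 𝒪 of absolute norm 3, and a fractional ideal 𝔞 of F with (8β)·𝔡·𝔭 = 𝔞² if and only if every prime p dividing D satisfies p ≡ 0 or 1 (mod 3). -/

import Mathlib

open scoped NumberField nonZeroDivisors

theorem isSquare_neg_three_of_mod_three_eq_one {p : ℕ} [Fact p.Prime] (h : p % 3 = 1) :
    IsSquare (-3 : ZMod p) := by
  have h3 : 3 ∣ Fintype.card (ZMod p)ˣ := by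
    rw [ZMod.card_units]
    have := (Fact.out : p.Prime).one_lt
    omega
  have : Fact (Nat.Prime 3) := ⟨Nat.prime_three⟩
  obtain ⟨u, hu⟩ := exists_prime_orderOf_dvd_card 3 h3
  have hu3 : (u : ZMod p) ^ 3 = 1 := by
    rw [← Units.val_pow_eq_pow_val, ← hu, pow_orderOf_eq_one, Units.val_one]
  have hu1 : (u : ZMod p) ≠ 1 := by
    intro h1
    rw [Units.val_eq_one] at h1
    simp [h1] at hu
  have : (u : ZMod p) ^ 2 + u + 1 = 0 := by
    apply mul_left_cancel₀ (sub_ne_zero.2 hu1)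
    linear_combination hu3
  exact ⟨2 * u + 1, by linear_combination -4 * this⟩

theorem mod_three_eq_one_of_isSquare_neg_three {p : ℕ} [Fact p.Prime] (h2 : p ≠ 2) (h3 : p ≠ 3)
    (h : IsSquare (-3 : ZMod p)) : p % 3 = 1 := by
  obtain ⟨s, hs⟩ := h
  have hp : p.Prime := Fact.out
  have two : (2 : ZMod p) ≠ 0 := by
    intro h0
    exact h2 ((Nat.prime_dvd_prime_iff_eq hp Nat.prime_two).1
      ((ZMod.natCast_eq_zero_iff 2 p).1 (by exact_mod_cast h0)))
  have three : (3 : ZMod p) ≠ 0 := by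
    intro h0
    exact h3 ((Nat.prime_dvd_prime_iff_eq hp Nat.prime_three).1
      ((ZMod.natCast_eq_zero_iff 3 p).1 (by exact_mod_cast h0)))
  set x : ZMod p := (s - 1) / 2 with hx
  have hx' : s = 2 * x + 1 := by rw [hx]; field_simp; ring
  have hq : x ^ 2 + x + 1 = 0 := by
    have : (2 * 2 : ZMod p) * (x ^ 2 + x + 1) = 0 := by
      rw [hx'] at hs
      linear_combination -hs
    exact (mul_eq_zero.1 this).resolve_left (mul_ne_zero two two)
  have : Fact (Nat.Prime 3) := ⟨Nat.prime_three⟩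
  have ho : orderOf x = 3 := by
    apply orderOf_eq_prime
    · linear_combination (x - 1) * hq
    · intro h1
      rw [h1] at hq
      exact three (by linear_combination hq)
  have hx0 : x ≠ 0 := by
    intro h0
    simp [h0] at hq
  have := ZMod.orderOf_dvd_card_sub_one hx0
  rw [ho] at this
  have := hp.one_lt
  omega

/-- Thue's lemma. -/
theorem exists_small_residue {p : ℕ} (hp : p.Prime) (t : ZMod p) :
    ∃ a b : ℤ, (a ≠ 0 ∨ b ≠ 0) ∧ a ^ 2 < p ∧ b ^ 2 < p ∧ (a : ZMod p) = t * b := by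
  have : Fact p.Prime := ⟨hp⟩
  set n := p.sqrt + 1 with hn
  have hcard : (Finset.univ : Finset (ZMod p)).card <
      (Finset.range n ×ˢ Finset.range n).card := by
    rw [Finset.card_univ, ZMod.card, Finset.card_product, Finset.card_range]
    exact Nat.lt_succ_sqrt p
  obtain ⟨⟨a, b⟩, hab, ⟨c, d⟩, hcd, hne, heq⟩ :=
    Finset.exists_ne_map_eq_of_card_lt_of_maps_to hcard
      (f := fun x : ℕ × ℕ => (x.1 : ZMod p) - t * x.2) (fun _ _ => Finset.mem_univ _)
  simp only [Finset.mem_product, Finset.mem_range] at hab hcd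
  have hsq : p.sqrt ^ 2 < p := by
    refine lt_of_le_of_ne (Nat.sqrt_le' p) fun h => ?_
    exact hp.prime.not_isSquare ⟨p.sqrt, by rw [← sq, h]⟩
  have key : ∀ u v : ℕ, u < n → v < n → ((u : ℤ) - v) ^ 2 < p := by
    intro u v hu hv
    have h1 : ((u : ℤ) - v) ^ 2 ≤ (p.sqrt : ℤ) ^ 2 := by
      apply sq_le_sq'
      · omega
      · omega
    have h2 : (p.sqrt : ℤ) ^ 2 < p := by exact_mod_cast hsq
    omega
  refine ⟨(a : ℤ) - c, (b : ℤ) - d, ?_, key a c hab.1 hcd.1, key b d hab.2 hcd.2, ?_⟩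
  · by_contra! h
    apply hne
    ext <;> simp <;> omega
  · push_cast
    linear_combination heq

theorem Nat.Prime.exists_sq_add_three_mul_sq {p : ℕ} (hp : p.Prime) (h : p % 3 = 1) :
    ∃ a b : ℤ, (p : ℤ) = a ^ 2 + 3 * b ^ 2 := by
  have : Fact p.Prime := ⟨hp⟩
  obtain ⟨t, ht⟩ := isSquare_neg_three_of_mod_three_eq_one h
  obtain ⟨a, b, h0, ha, hb, hab⟩ := exists_small_residue hp t
  obtain ⟨k, hk⟩ : (p : ℤ) ∣ a ^ 2 + 3 * b ^ 2 := by
    rw [← ZMod.intCast_zmod_eq_zero_iff_dvd]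
    push_cast
    rw [hab]
    linear_combination -(b : ZMod p) ^ 2 * ht
  have hpos : 0 < a ^ 2 + 3 * b ^ 2 := by
    rcases h0 with h0 | h0 <;> positivity
  have hp0 : (0 : ℤ) < p := by exact_mod_cast hp.pos
  have hk0 : 0 < k := by
    rw [hk] at hpos
    exact pos_of_mul_pos_right hpos hp0.le
  have hk4 : k < 4 := by nlinarith
  interval_cases k
  · exact ⟨a, b, by linarith⟩
  · exfalso
    have hodd : (p : ℤ) % 2 = 1 := by
      rcases hp.eq_two_or_odd with h2 | h2
      · omega
      · omega
    rcases Int.even_or_odd' a with ⟨c, rfl | rfl⟩ <;>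
    rcases Int.even_or_odd' b with ⟨d, rfl | rfl⟩ <;> ring_nf at hk <;> omega
  · obtain ⟨c, rfl⟩ : (3 : ℤ) ∣ a :=
      Int.prime_three.dvd_of_dvd_pow (n := 2) ⟨p - b ^ 2, by linarith⟩
    exact ⟨b, c, by linarith⟩

theorem exists_sq_add_three_mul_sq (n : ℕ) (hn : n ≠ 0)
    (h : ∀ p : ℕ, p.Prime → p ∣ n → p % 3 = 0 ∨ p % 3 = 1) :
    ∃ a b : ℤ, (n : ℤ) = a ^ 2 + 3 * b ^ 2 := by
  induction n using induction_on_primes with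
  | zero => exact absurd rfl hn
  | one => exact ⟨1, 0, by simp⟩
  | prime_mul p m hp ih =>
    obtain ⟨c, d, hcd⟩ := ih (by rintro rfl; simp at hn)
      fun q hq hqm => h q hq (dvd_mul_of_dvd_right hqm p)
    obtain ⟨a, b, hab⟩ : ∃ a b : ℤ, (p : ℤ) = a ^ 2 + 3 * b ^ 2 := by
      rcases h p hp (dvd_mul_right p m) with h0 | h1
      · have : 3 = p := (Nat.prime_dvd_prime_iff_eq Nat.prime_three hp).1
          (Nat.dvd_of_mod_eq_zero h0)
        exact ⟨0, 1, by simp [← this]⟩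
      · exact hp.exists_sq_add_three_mul_sq h1
    exact ⟨a * c - 3 * b * d, a * d + b * c, by push_cast; rw [hab, hcd]; ring⟩

theorem isSquare_neg_three_of_dvd {p : ℕ} (hp : p.Prime) (h3 : p ≠ 3) {D : ℤ}
    (hsq : Squarefree D) (hpD : (p : ℤ) ∣ D) (A B S : ℤ) (hS : S ≠ 0)
    (h : 3 * A ^ 2 = D * (S ^ 2 + 3 * B ^ 2)) : IsSquare (-3 : ZMod p) := by
  have : Fact p.Prime := ⟨hp⟩
  have hpZ : Prime (p : ℤ) := Nat.prime_iff_prime_int.1 hp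
  have hp3 : ¬ (p : ℤ) ∣ 3 := by
    intro hd
    exact h3 ((Nat.prime_dvd_prime_iff_eq hp Nat.prime_three).1 (by exact_mod_cast hd))
  obtain ⟨E, rfl⟩ := hpD
  have hE : ¬ (p : ℤ) ∣ E := fun hd => hpZ.not_isUnit (hsq _ (mul_dvd_mul_left _ hd))
  induction hk : S.natAbs using Nat.strong_induction_on generalizing A B S with
  | _ k ih =>
    obtain ⟨A', rfl⟩ : (p : ℤ) ∣ A := by
      have : (p : ℤ) ∣ 3 * A ^ 2 := h ▸ (dvd_mul_right _ _).mul_right _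
      exact hpZ.dvd_of_dvd_pow ((hpZ.dvd_or_dvd this).resolve_left hp3)
    have h' : 3 * (p * A' ^ 2) = E * (S ^ 2 + 3 * B ^ 2) := by
      apply mul_left_cancel₀ hpZ.ne_zero
      linear_combination h
    have hd : (p : ℤ) ∣ S ^ 2 + 3 * B ^ 2 :=
      (hpZ.dvd_or_dvd (⟨3 * A' ^ 2, by rw [← h']; ring⟩ : (p : ℤ) ∣ E * _)).resolve_left hE
    by_cases hB : (p : ℤ) ∣ B
    · obtain ⟨B', rfl⟩ := hB
      obtain ⟨S', rfl⟩ : (p : ℤ) ∣ S := by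
        apply hpZ.dvd_of_dvd_pow (n := 2)
        rw [← dvd_add_left (b := S ^ 2) (c := 3 * (p * B') ^ 2) ⟨3 * p * B' ^ 2, by ring⟩]
        exact hd
      have hS' : S' ≠ 0 := by rintro rfl; simp at hS
      refine ih S'.natAbs ?_ A' B' S' hS' ?_ rfl
      · rw [← hk, Int.natAbs_mul, Int.natAbs_natCast]
        have := Int.natAbs_pos.2 hS'
        nlinarith [hp.two_le]
      · apply mul_left_cancel₀ hpZ.ne_zero
        linear_combination h'
    · have hB0 : (B : ZMod p) ≠ 0 := by rwa [Ne, ZMod.intCast_zmod_eq_zero_iff_dvd]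
      rw [← ZMod.intCast_zmod_eq_zero_iff_dvd] at hd
      push_cast at hd
      refine ⟨S / B, ?_⟩
      field_simp
      linear_combination -hd

theorem isSquare_neg_three_of_dvd_rat {p : ℕ} (hp : p.Prime) (h3 : p ≠ 3) {D : ℤ}
    (hsq : Squarefree D) (hpD : (p : ℤ) ∣ D) (a b s : ℚ) (hs : s ≠ 0)
    (h : 3 * a ^ 2 = D * (s ^ 2 + 3 * b ^ 2)) : IsSquare (-3 : ZMod p) := by
  have ha := Rat.mul_den_eq_num a
  have hb := Rat.mul_den_eq_num b
  have hs' := Rat.mul_den_eq_num s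
  refine isSquare_neg_three_of_dvd hp h3 hsq hpD (a.num * b.den * s.den) (b.num * a.den * s.den)
    (s.num * a.den * b.den) (by simp [hs]) ?_
  have : (3 * (a.num * b.den * s.den) ^ 2 : ℚ) =
      D * ((s.num * a.den * b.den) ^ 2 + 3 * (b.num * a.den * s.den) ^ 2) := by
    rw [← ha, ← hb, ← hs']
    linear_combination (a.den * b.den * s.den : ℚ) ^ 2 * h
  exact_mod_cast this

/-- If `D` is square-free and `D * c ^ 2` is an integer, then so is `c`. -/
theorem Squarefree.exists_intCast_eq_of_mul_sq {D : ℤ} (hsq : Squarefree D) (c : ℚ) (t : ℤ)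
    (h : (D : ℚ) * c ^ 2 = t) : ∃ k : ℤ, c = k := by
  have hc := Rat.mul_den_eq_num c
  have h1 : D * c.num ^ 2 = t * (c.den : ℤ) ^ 2 := by
    have : (D * c.num ^ 2 : ℚ) = t * c.den ^ 2 := by
      rw [← hc, ← h]
      ring
    exact_mod_cast this
  have hcop : IsCoprime ((c.den : ℤ) ^ 2) (c.num ^ 2) :=
    (Int.isCoprime_iff_gcd_eq_one.2 (by
      rw [Int.gcd_comm]; exact c.reduced)).pow
  have hd : (c.den : ℤ) * c.den ∣ D := by
    rw [← sq]
    exact hcop.dvd_of_dvd_mul_right ⟨t, by rw [h1]; ring⟩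
  have hu := Int.isUnit_iff.1 (hsq _ hd)
  have h2 : (c.den : ℤ) = 1 := by omega
  refine ⟨c.num, ?_⟩
  rw [← hc]
  have : (c.den : ℚ) = 1 := by exact_mod_cast h2
  rw [this, mul_one]

theorem Squarefree.sq_ne_intCast {D : ℤ} (hsq : Squarefree D) (hD1 : 1 < D) (r : ℚ) :
    r ^ 2 ≠ (D : ℚ) := by
  intro h
  obtain ⟨k, rfl⟩ := (squarefree_one (R := ℤ)).exists_intCast_eq_of_mul_sq r D (by simpa using h)
  have h1 : k * k = D := by rw [← sq]; exact_mod_cast h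
  have := Int.isUnit_iff.1 (hsq k h1.dvd)
  rcases this with rfl | rfl <;> omega

section Quadratic

variable {F : Type*} [Field F] [CharZero F] {D : ℤ} {sd : F}

theorem exists_eq_add_mul_of_adjoin_eq_top (hsd : sd ^ 2 = (D : F))
    (hadj : Algebra.adjoin ℚ {sd} = ⊤) (x : F) : ∃ a b : ℚ, x = a + b * sd := by
  have hx : x ∈ Algebra.adjoin ℚ {sd} := hadj ▸ Algebra.mem_top
  induction hx using Algebra.adjoin_induction with
  | mem x hx => exact ⟨0, 1, by simpa using hx⟩
  | algebraMap r => exact ⟨r, 0, by simp⟩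
  | add x y _ _ hx hy =>
    obtain ⟨a, b, rfl⟩ := hx
    obtain ⟨c, d, rfl⟩ := hy
    exact ⟨a + c, b + d, by push_cast; ring⟩
  | mul x y _ _ hx hy =>
    obtain ⟨a, b, rfl⟩ := hx
    obtain ⟨c, d, rfl⟩ := hy
    exact ⟨a * c + D * (b * d), a * d + b * c, by push_cast; linear_combination (b * d : F) * hsd⟩

theorem eq_zero_of_add_mul_eq_zero (hsq : ∀ r : ℚ, r ^ 2 ≠ (D : ℚ)) (hsd : sd ^ 2 = (D : F))
    {a b : ℚ} (h : (a : F) + b * sd = 0) : a = 0 ∧ b = 0 := by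
  have hb : b = 0 := by
    by_contra hb
    have hbF : (b : F) ≠ 0 := by exact_mod_cast hb
    apply hsq (-a / b)
    have : sd = ((-a / b : ℚ) : F) := by
      push_cast
      field_simp
      linear_combination h
    rw [this] at hsd
    exact_mod_cast hsd
  subst hb
  exact ⟨by simpa using h, rfl⟩

/-- The basis `1, √D` of the quadratic field `ℚ(√D)`. -/
noncomputable def sqrtBasis (hsq : ∀ r : ℚ, r ^ 2 ≠ (D : ℚ)) (hsd : sd ^ 2 = (D : F))
    (hadj : Algebra.adjoin ℚ {sd} = ⊤) : Module.Basis (Fin 2) ℚ F :=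
  Module.Basis.mk (v := ![1, sd])
    (by
      rw [LinearIndependent.pair_iff]
      intro s t h
      refine eq_zero_of_add_mul_eq_zero hsq hsd ?_
      simpa [Algebra.smul_def] using h)
    (by
      intro x _
      obtain ⟨a, b, rfl⟩ := exists_eq_add_mul_of_adjoin_eq_top hsd hadj x
      simp only [Matrix.range_cons, Matrix.range_empty, Set.union_empty, Set.singleton_union]
      rw [Submodule.mem_span_pair]
      exact ⟨a, b, by simp [Algebra.smul_def]⟩)

theorem leftMulMatrix_sqrtBasis (hsq : ∀ r : ℚ, r ^ 2 ≠ (D : ℚ)) (hsd : sd ^ 2 = (D : F))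
    (hadj : Algebra.adjoin ℚ {sd} = ⊤) (a b : ℚ) :
    Algebra.leftMulMatrix (sqrtBasis hsq hsd hadj) (a + b * sd) = !![a, D * b; b, a] := by
  set B := sqrtBasis hsq hsd hadj with hB
  have h0 : B 0 = 1 := by simp [hB, sqrtBasis]
  have h1 : B 1 = sd := by simp [hB, sqrtBasis]
  have hrepr (c d : ℚ) : ∀ i, B.repr (c + d * sd) i = ![c, d] i := by
    intro i
    have : (c + d * sd : F) = ∑ i, ![c, d] i • B i := by
      simp [Fin.sum_univ_two, h0, h1, Algebra.smul_def]
    rw [this, B.repr_sum_self]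
  have e1 : (a + b * sd) * sd = ((D * b : ℚ) : F) + a * sd := by
    push_cast
    linear_combination (b : F) * hsd
  ext i j
  rw [Algebra.leftMulMatrix_eq_repr_mul]
  fin_cases j
  · simp only [Fin.zero_eta, h0, mul_one, hrepr]
    fin_cases i <;> simp
  · simp only [Fin.mk_one, h1, e1, hrepr]
    fin_cases i <;> simp

theorem norm_add_mul_sqrt (hsq : ∀ r : ℚ, r ^ 2 ≠ (D : ℚ)) (hsd : sd ^ 2 = (D : F))
    (hadj : Algebra.adjoin ℚ {sd} = ⊤) (a b : ℚ) :
    Algebra.norm ℚ (a + b * sd) = a ^ 2 - D * b ^ 2 := by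
  rw [Algebra.norm_eq_matrix_det (sqrtBasis hsq hsd hadj), leftMulMatrix_sqrtBasis,
    Matrix.det_fin_two_of]
  ring

theorem trace_add_mul_sqrt (hsq : ∀ r : ℚ, r ^ 2 ≠ (D : ℚ)) (hsd : sd ^ 2 = (D : F))
    (hadj : Algebra.adjoin ℚ {sd} = ⊤) (a b : ℚ) :
    Algebra.trace ℚ F (a + b * sd) = 2 * a := by
  rw [Algebra.trace_eq_matrix_trace (sqrtBasis hsq hsd hadj), leftMulMatrix_sqrtBasis,
    Matrix.trace_fin_two_of]
  ring

theorem minpoly_rat_eq_sq_sub (hsq : ∀ r : ℚ, r ^ 2 ≠ (D : ℚ)) (hsd : sd ^ 2 = (D : F)) :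
    minpoly ℚ sd = Polynomial.X ^ 2 - Polynomial.C (D : ℚ) := by
  have hmon : (Polynomial.X ^ 2 - Polynomial.C (D : ℚ)).Monic :=
    Polynomial.monic_X_pow_sub_C _ two_ne_zero
  have haev : Polynomial.aeval sd (Polynomial.X ^ 2 - Polynomial.C (D : ℚ)) = 0 := by
    simp [hsd]
  have hint : IsIntegral ℚ sd := ⟨_, hmon, haev⟩
  refine (Polynomial.eq_of_monic_of_dvd_of_natDegree_le (minpoly.monic hint) hmon
    (minpoly.dvd ℚ sd haev) ?_).symm
  rw [Polynomial.natDegree_X_pow_sub_C, minpoly.two_le_natDegree_iff hint]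
  rintro ⟨r, rfl⟩
  apply hsq r
  rw [eq_ratCast] at hsd
  exact_mod_cast hsd

theorem exists_ringHom_real (hsq : ∀ r : ℚ, r ^ 2 ≠ (D : ℚ)) (hsd : sd ^ 2 = (D : F))
    (hadj : Algebra.adjoin ℚ {sd} = ⊤) {r : ℝ} (hr : r ^ 2 = D) :
    ∃ φ : F →+* ℝ, φ sd = r := by
  have hint : IsIntegral ℚ sd :=
    ⟨_, Polynomial.monic_X_pow_sub_C (D : ℚ) two_ne_zero, by
      rw [← Polynomial.aeval_def]
      simp [hsd]⟩
  set pb := PowerBasis.ofAdjoinEqTop hint hadj with hpb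
  have hgen : pb.gen = sd := PowerBasis.ofAdjoinEqTop_gen hint hadj
  have h0 : Polynomial.aeval r (minpoly ℚ pb.gen) = 0 := by
    rw [hgen, minpoly_rat_eq_sq_sub hsq hsd]
    simp [hr]
  refine ⟨(pb.lift r h0).toRingHom, ?_⟩
  have := pb.lift_gen r h0
  rwa [hgen] at this

theorem norm_pos_of_forall_ringHom_real_pos (hsq : ∀ r : ℚ, r ^ 2 ≠ (D : ℚ)) (hD : 0 ≤ D)
    (hsd : sd ^ 2 = (D : F)) (hadj : Algebra.adjoin ℚ {sd} = ⊤) {x : F}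
    (hx : ∀ φ : F →+* ℝ, 0 < φ x) : 0 < Algebra.norm ℚ x := by
  obtain ⟨a, b, rfl⟩ := exists_eq_add_mul_of_adjoin_eq_top hsd hadj x
  rw [norm_add_mul_sqrt hsq hsd hadj]
  have hs : √(D : ℝ) ^ 2 = D := Real.sq_sqrt (by exact_mod_cast hD)
  obtain ⟨φ, hφ⟩ := exists_ringHom_real hsq hsd hadj hs
  obtain ⟨ψ, hψ⟩ := exists_ringHom_real hsq hsd hadj (r := -√(D : ℝ)) (by rw [neg_sq, hs])
  have h := mul_pos (hx φ) (hx ψ)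
  simp only [map_add, map_mul, map_ratCast, hφ, hψ] at h
  have : (0 : ℝ) < a ^ 2 - D * b ^ 2 := by
    rw [← hs]
    linarith
  exact_mod_cast this

end Quadratic

section RingOfIntegers

variable {F : Type*} [Field F] [NumberField F] {D : ℤ} {sd : F}

theorem exists_ringOfIntegers_half (hsd : sd ^ 2 = (D : F)) {y n : ℤ} (h : D = y ^ 2 + 4 * n) :
    ∃ η : 𝓞 F, 2 * (η : F) = y + sd ∧ η ^ 2 = y * η + n := by
  have hroot : ((y + sd) / 2 : F) ^ 2 = y * ((y + sd) / 2) + n := by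
    have : (D : F) = y ^ 2 + 4 * n := by exact_mod_cast congrArg (Int.cast : ℤ → F) h
    field_simp
    linear_combination hsd + this
  have hint : IsIntegral ℤ ((y + sd) / 2 : F) := by
    refine ⟨Polynomial.X ^ 2 - (Polynomial.C y * Polynomial.X + Polynomial.C n), ?_, ?_⟩
    · monicity!
    · rw [← Polynomial.aeval_def]
      simp [hroot]
  refine ⟨⟨_, hint⟩, ?_, ?_⟩
  · change 2 * ((y + sd) / 2) = _
    field_simp
  · apply NumberField.RingOfIntegers.ext
    simp only [map_add, map_intCast]
    exact hroot

theorem exists_eq_intCast_add_mul (hsq : Squarefree D) (hD1 : 1 < D)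
    (hsd : sd ^ 2 = (D : F)) (hadj : Algebra.adjoin ℚ {sd} = ⊤) {y n : ℤ}
    (h : D = y ^ 2 + 4 * n) {η : 𝓞 F} (hη : 2 * (η : F) = y + sd) (x : 𝓞 F) :
    ∃ u v : ℤ, x = u + v * η := by
  obtain ⟨a, b, hab⟩ := exists_eq_add_mul_of_adjoin_eq_top hsd hadj (x : F)
  have hns := hsq.sq_ne_intCast hD1
  have hxint : IsIntegral ℤ (x : F) := x.isIntegral_coe
  obtain ⟨t, ht⟩ := IsIntegrallyClosed.isIntegral_iff.1 (Algebra.isIntegral_trace (L := ℚ) hxint)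
  obtain ⟨m, hm⟩ := IsIntegrallyClosed.isIntegral_iff.1 (Algebra.isIntegral_norm ℚ hxint)
  rw [hab, trace_add_mul_sqrt hns hsd hadj] at ht
  rw [hab, norm_add_mul_sqrt hns hsd hadj] at hm
  simp only [algebraMap_int_eq, eq_intCast] at ht hm
  obtain ⟨k, hk⟩ := hsq.exists_intCast_eq_of_mul_sq (2 * b) (t ^ 2 - 4 * m) (by
    push_cast
    rw [ht, hm]
    ring)
  have hZ : t ^ 2 - D * k ^ 2 = 4 * m := by
    have : (t ^ 2 - D * k ^ 2 : ℚ) = 4 * m := by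
      rw [← hk, ht, hm]
      ring
    exact_mod_cast this
  obtain ⟨u, hu⟩ : Even (t - k * y) := by
    have : Even (t ^ 2 - (k * y) ^ 2) := ⟨2 * m + 2 * n * k ^ 2, by
      rw [h] at hZ
      linear_combination hZ⟩
    rw [Int.even_sub] at this ⊢
    simpa [Int.even_pow, parity_simps] using this
  refine ⟨u, k, ?_⟩
  apply NumberField.RingOfIntegers.ext
  have hk' : (2 * b : F) = k := by exact_mod_cast congrArg (Rat.cast : ℚ → F) hk
  have ht' : (t : F) = 2 * a := by exact_mod_cast congrArg (Rat.cast : ℚ → F) ht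
  have hu' : (t - k * y : F) = u + u := by exact_mod_cast congrArg (Int.cast : ℤ → F) hu
  rw [hab]
  simp only [map_add, map_mul, map_intCast]
  apply mul_left_cancel₀ (two_ne_zero (α := F))
  linear_combination hu' - ht' + (sd : F) * hk' - (k : F) * hη

theorem adjoin_eq_top_of_half (hadj : Algebra.adjoin ℚ {sd} = ⊤) {y : ℤ} {η : F}
    (hη : 2 * η = y + sd) : Algebra.adjoin ℚ {η} = ⊤ := by
  rw [eq_top_iff, ← hadj, Algebra.adjoin_le_iff, Set.singleton_subset_iff]
  have hs : sd = 2 * η - y := by rw [hη]; ring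
  rw [hs]
  exact sub_mem (mul_mem (ofNat_mem _ 2) (Algebra.self_mem_adjoin_singleton ℚ η))
    (intCast_mem _ y)

theorem differentIdeal_eq_span (hsq : Squarefree D) (hD1 : 1 < D)
    (hsd : sd ^ 2 = (D : F)) (hadj : Algebra.adjoin ℚ {sd} = ⊤) {y n : ℤ}
    (h : D = y ^ 2 + 4 * n) {η : 𝓞 F} (hη : 2 * (η : F) = y + sd)
    (hη2 : η ^ 2 = y * η + n) :
    differentIdeal ℤ (𝓞 F) = Ideal.span {2 * η - y} := by
  have hmin : minpoly ℤ η =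
      Polynomial.X ^ 2 - (Polynomial.C y * Polynomial.X + Polynomial.C n) := by
    have hmon : (Polynomial.X ^ 2 - (Polynomial.C y * Polynomial.X + Polynomial.C n)).Monic := by
      monicity!
    have haev : Polynomial.aeval η
        (Polynomial.X ^ 2 - (Polynomial.C y * Polynomial.X + Polynomial.C n)) = 0 := by
      simp [hη2]
    have hint : IsIntegral ℤ η := ⟨_, hmon, haev⟩
    refine (Polynomial.eq_of_monic_of_dvd_of_natDegree_le (minpoly.monic hint) hmon
      (minpoly.isIntegrallyClosed_dvd hint haev) ?_).symm
    have hdeg : (Polynomial.X ^ 2 - (Polynomial.C y * Polynomial.X + Polynomial.C n)).natDegree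
        = 2 := by
      compute_degree!
    rw [hdeg, minpoly.two_le_natDegree_iff hint]
    rintro ⟨r, rfl⟩
    apply hsq.sq_ne_intCast hD1 (2 * r - y)
    have : sd = 2 * r - y := by
      simp only [algebraMap_int_eq, eq_intCast, map_intCast] at hη
      linear_combination -hη
    rw [this] at hsd
    exact_mod_cast hsd
  have hcond : conductor ℤ η = ⊤ := by
    rw [conductor_eq_top_iff_adjoin_eq_top, eq_top_iff]
    intro x _
    obtain ⟨u, v, rfl⟩ := exists_eq_intCast_add_mul hsq hD1 hsd hadj h hη x
    exact add_mem (intCast_mem _ u)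
      (mul_mem (intCast_mem _ v) (Algebra.self_mem_adjoin_singleton ℤ η))
  have := conductor_mul_differentIdeal ℤ ℚ F η (adjoin_eq_top_of_half hadj hη)
  rw [hcond, Ideal.top_mul, hmin] at this
  simp only [Polynomial.derivative_sub, Polynomial.derivative_add, Polynomial.derivative_X_pow,
    Polynomial.derivative_C_mul, Polynomial.derivative_X, Polynomial.derivative_C] at this
  simpa [map_ofNat (Polynomial.aeval η) 2] using this

end RingOfIntegers

section Main

variable {F : Type*} [Field F] [NumberField F] {D : ℤ} {sd : F}

theorem coeIdeal_differentIdeal_eq_spanSingleton (hsq : Squarefree D) (hD1 : 1 < D)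
    (hsd : sd ^ 2 = (D : F)) (hadj : Algebra.adjoin ℚ {sd} = ⊤) {y n : ℤ}
    (h : D = y ^ 2 + 4 * n) :
    (differentIdeal ℤ (𝓞 F) : FractionalIdeal (𝓞 F)⁰ F) =
      FractionalIdeal.spanSingleton (𝓞 F)⁰ sd := by
  obtain ⟨η, hη, hη2⟩ := exists_ringOfIntegers_half hsd h
  rw [differentIdeal_eq_span hsq hD1 hsd hadj h hη hη2, FractionalIdeal.coeIdeal_span_singleton]
  congr 1
  simp only [map_sub, map_mul, map_ofNat, map_intCast]
  linear_combination hη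

theorem absNorm_span_half (hsq : Squarefree D) (hD1 : 1 < D)
    (hsd : sd ^ 2 = (D : F)) (hadj : Algebra.adjoin ℚ {sd} = ⊤) {y n : ℤ}
    (h : D = y ^ 2 + 4 * n) {η : 𝓞 F} (hη : 2 * (η : F) = y + sd) :
    Ideal.absNorm (Ideal.span {η}) = n.natAbs := by
  rw [Ideal.absNorm_span_singleton]
  have hη' : (η : F) = ((y / 2 : ℚ) : F) + ((1 / 2 : ℚ) : F) * sd := by
    push_cast
    linear_combination hη / 2
  have h1 : ((Algebra.norm ℤ η : ℤ) : ℚ) = -n := by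
    rw [Algebra.coe_norm_int, hη', norm_add_mul_sqrt (hsq.sq_ne_intCast hD1) hsd hadj, h]
    push_cast
    ring
  have h2 : Algebra.norm ℤ η = -n := by exact_mod_cast h1
  rw [h2, Int.natAbs_neg]

theorem span_pair_sq_eq {R : Type*} [CommRing R] {η y w : R} (hη : η ^ 2 = y * η + 3 * w ^ 2)
    (hcop : IsCoprime y w) :
    Ideal.span {η, 3 * w} ^ 2 = Ideal.span {η} * Ideal.span {3, η} := by
  obtain ⟨u, v, huv⟩ := hcop
  have h1 : Ideal.span {η} * Ideal.span {3, η} = Ideal.span {η * 3, η * η} := by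
    rw [Ideal.span_mul_span', Set.singleton_mul, Set.image_pair]
  rw [sq, Ideal.span_pair_mul_span_pair, h1]
  apply le_antisymm
  · simp only [Ideal.span_le, Set.insert_subset_iff, Set.singleton_subset_iff, SetLike.mem_coe,
      Ideal.mem_span_pair]
    exact ⟨⟨0, 1, by ring⟩, ⟨w, 0, by ring⟩, ⟨w, 0, by ring⟩,
      ⟨-y, 3, by linear_combination 3 * hη⟩⟩
  · simp only [Ideal.span_le, Set.insert_subset_iff, Set.singleton_subset_iff, SetLike.mem_coe]
    refine ⟨?_, Ideal.subset_span (by simp)⟩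
    have : η * 3 = v * (η * (3 * w)) + (3 * u) * (η * η) + (-u) * (3 * w * (3 * w)) := by
      linear_combination -(3 * η) * huv - 3 * u * hη
    rw [this]
    refine add_mem (add_mem ?_ ?_) ?_ <;>
      exact Ideal.mul_mem_left _ _ (Ideal.subset_span (by simp))

theorem absNorm_eq_three_of_sq_eq (hsq : Squarefree D) (hD1 : 1 < D)
    (hsd : sd ^ 2 = (D : F)) (hadj : Algebra.adjoin ℚ {sd} = ⊤)
    {a P : Ideal (𝓞 F)} {η : 𝓞 F} {w : ℤ} (hw : w ≠ 0)
    (hη : Ideal.absNorm (Ideal.span {η}) = (3 * w ^ 2).natAbs) (h3 : 3 ∈ P)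
    (h : a ^ 2 = Ideal.span {η} * P) :
    Ideal.absNorm P = 3 := by
  have h9 : Ideal.absNorm P ∣ 3 ^ 2 := by
    have h1 := Ideal.absNorm_dvd_norm_of_mem h3
    have h2 : Algebra.norm ℤ (3 : 𝓞 F) = 9 := by
      have h4 : ((3 : 𝓞 F) : F) = ((3 : ℚ) : F) + ((0 : ℚ) : F) * sd := by
        simp [map_ofNat (algebraMap (𝓞 F) F) 3]
      have h5 : ((Algebra.norm ℤ (3 : 𝓞 F) : ℤ) : ℚ) = 9 := by
        rw [Algebra.coe_norm_int, h4, norm_add_mul_sqrt (hsq.sq_ne_intCast hD1) hsd hadj]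
        norm_num
      exact_mod_cast h5
    rw [h2] at h1
    exact_mod_cast h1
  have hN := congrArg Ideal.absNorm h
  rw [map_pow, map_mul, hη] at hN
  have hno (A W : ℤ) (hW : W ≠ 0) : A ^ 2 ≠ 3 * W ^ 2 := by
    intro hA
    apply Int.prime_three.squarefree.sq_ne_intCast (by norm_num) ((A : ℚ) / W)
    have hWQ : (W : ℚ) ≠ 0 := by exact_mod_cast hW
    field_simp
    exact_mod_cast hA.trans (mul_comm _ _)
  have hNZ : (Ideal.absNorm a : ℤ) ^ 2 = 3 * w ^ 2 * Ideal.absNorm P := by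
    have : ((3 * w ^ 2).natAbs : ℤ) = 3 * w ^ 2 := Int.natAbs_of_nonneg (by positivity)
    rw [← this]
    exact_mod_cast hN
  obtain ⟨k, hk, hP⟩ := (Nat.dvd_prime_pow Nat.prime_three).1 h9
  rw [hP] at hNZ
  interval_cases k
  · exact absurd (by simpa using hNZ) (hno _ w hw)
  · exact hP
  · refine absurd ?_ (hno (Ideal.absNorm a) (3 * w) (by simpa using hw))
    rw [hNZ]
    push_cast
    ring

theorem exists_eq_sq_add_mul_sq_of_mod_eight (hsq : Squarefree D) (hD1 : 1 < D) (hD8 : D % 8 = 1)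
    (h : ∀ p : ℕ, p.Prime → (p : ℤ) ∣ D → p % 3 = 0 ∨ p % 3 = 1) :
    ∃ y w : ℤ, D = y ^ 2 + 4 * (3 * w ^ 2) ∧ w ≠ 0 ∧ IsCoprime y w := by
  obtain ⟨y, z, hyz⟩ := exists_sq_add_three_mul_sq D.natAbs (by omega)
    fun p hp hpD => h p hp (Int.natCast_dvd.2 hpD)
  rw [Int.natAbs_of_nonneg (by omega)] at hyz
  obtain ⟨w, rfl⟩ : Even z := by
    rcases Int.even_or_odd z with hz | hz
    · exact hz
    exfalso
    have hz8 := Int.sq_mod_four_eq_one_of_odd hz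
    rcases Int.even_or_odd' y with ⟨c, rfl | rfl⟩ <;> obtain ⟨d, rfl⟩ := hz
    · obtain ⟨e, he⟩ := Int.even_mul_succ_self d
      obtain ⟨f, hf⟩ := Int.even_mul_succ_self c
      have hD : D = 4 * c ^ 2 + 24 * e + 3 := by rw [hyz]; linear_combination 12 * he
      omega
    · ring_nf at hyz
      omega
  have hyw : D = y ^ 2 + 4 * (3 * w ^ 2) := by rw [hyz]; ring
  have hcop : IsCoprime y w := by
    rw [Int.isCoprime_iff_gcd_eq_one]
    have h1 := Int.gcd_dvd_left y w
    have h2 := Int.gcd_dvd_right y w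
    have hd : (Int.gcd y w : ℤ) * Int.gcd y w ∣ D := by
      rw [hyw, sq, sq]
      exact dvd_add (mul_dvd_mul h1 h1) (((mul_dvd_mul h2 h2).mul_left _).mul_left _)
    have := Int.isUnit_iff.1 (hsq _ hd)
    omega
  refine ⟨y, w, hyw, ?_, hcop⟩
  rintro rfl
  rw [isCoprime_zero_right, Int.isUnit_iff] at hcop
  rcases hcop with rfl | rfl <;> norm_num at hyw <;> omega

end Main

/-- Let `D > 1` be square-free with `D ≡ 1 (mod 8)`, `F = ℚ(√D)`,
`𝒪` its ring of integers and `𝔡` the different of `F/ℚ`.  There exist a totally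
positive `β ∈ F^×`, a prime ideal `𝔭` of `𝒪` of absolute norm `3` and a
fractional ideal `𝔞` with `(8β)·𝔡·𝔭 = 𝔞²` if and only if every prime `p ∣ D`
satisfies `p ≡ 0` or `1 (mod 3)`. -/
theorem stmt13 (D : ℤ) (hD1 : 1 < D) (hsq : Squarefree D) (hD8 : D % 8 = 1)
    (F : Type*) [Field F] [NumberField F]
    (sd : F) (hsd : sd ^ 2 = (D : F)) (hadj : Algebra.adjoin ℚ {sd} = ⊤) :
    (∃ β : F, β ≠ 0 ∧ (∀ φ : F →+* ℝ, 0 < φ β) ∧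
      ∃ P : Ideal (𝓞 F), P.IsPrime ∧ Ideal.absNorm P = 3 ∧
        ∃ a : FractionalIdeal (𝓞 F)⁰ F, a ≠ 0 ∧
          FractionalIdeal.spanSingleton (𝓞 F)⁰ (8 * β)
              * (differentIdeal ℤ (𝓞 F) : FractionalIdeal (𝓞 F)⁰ F)
              * (P : FractionalIdeal (𝓞 F)⁰ F)
            = a ^ 2)
    ↔ (∀ p : ℕ, p.Prime → (p : ℤ) ∣ D → p % 3 = 0 ∨ p % 3 = 1) := by
  have hns := hsq.sq_ne_intCast hD1
  have hsd0 : sd ≠ 0 := by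
    rintro rfl
    apply hns 0
    have : ((0 : ℤ) : F) = ((D : ℤ) : F) := by simpa using hsd
    have : 0 = D := by exact_mod_cast this
    omega
  constructor
  · rintro ⟨β, hβ0, hβ, P, -, hP3, a, ha0, ha⟩ p hp hpD
    rcases eq_or_ne p 3 with rfl | hp3
    · exact Or.inl rfl
    right
    have : Fact p.Prime := ⟨hp⟩
    refine mod_three_eq_one_of_isSquare_neg_three (by rintro rfl; omega) hp3 ?_
    have hpos := norm_pos_of_forall_ringHom_real_pos hns (by omega) hsd hadj hβ
    rw [coeIdeal_differentIdeal_eq_spanSingleton hsq hD1 hsd hadj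
      (show D = 1 ^ 2 + 4 * (D / 4) by omega)] at ha
    have hN := congrArg FractionalIdeal.absNorm ha
    have hsdN : Algebra.norm ℚ sd = -D := by
      have := norm_add_mul_sqrt hns hsd hadj 0 1
      simpa using this
    have h8 : Algebra.norm ℚ (8 : F) = 64 := by
      have := norm_add_mul_sqrt hns hsd hadj 8 0
      norm_num at this
      exact this
    simp only [map_mul, map_pow, FractionalIdeal.absNorm_span_singleton,
      FractionalIdeal.coeIdeal_absNorm, hP3, hsdN, h8, abs_mul, abs_neg, abs_of_pos hpos] at hN
    have hDpos : (0 : ℚ) < D := by exact_mod_cast (by omega : 0 < D)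
    rw [abs_of_pos hDpos] at hN
    have hr0 : FractionalIdeal.absNorm a ≠ 0 := by
      rwa [Ne, FractionalIdeal.absNorm_eq_zero_iff]
    obtain ⟨x, y, hxy⟩ := exists_eq_add_mul_of_adjoin_eq_top hsd hadj β
    rw [hxy, norm_add_mul_sqrt hns hsd hadj] at hN
    refine isSquare_neg_three_of_dvd_rat hp hp3 hsq hpD x y (FractionalIdeal.absNorm a / (8 * D))
      (div_ne_zero hr0 (by positivity)) ?_
    field_simp
    norm_num at hN ⊢
    linear_combination hN
  · intro h
    obtain ⟨y, w, hyw, hw, hcop⟩ := exists_eq_sq_add_mul_sq_of_mod_eight hsq hD1 hD8 h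
    obtain ⟨η, hη, hη2⟩ := exists_ringOfIntegers_half hsd hyw
    have hη0 : (η : F) ≠ 0 := by
      intro h0
      rw [NumberField.RingOfIntegers.coe_eq_zero_iff] at h0
      simp [h0, hw] at hη2
    have hsqI : Ideal.span {η, 3 * (w : 𝓞 F)} ^ 2 = Ideal.span {η} * Ideal.span {3, η} :=
      span_pair_sq_eq (y := (y : 𝓞 F)) (by rw [hη2]; push_cast; ring)
        (hcop.map (Int.castRingHom (𝓞 F)))
    have hP3 := absNorm_eq_three_of_sq_eq hsq hD1 hsd hadj hw
      (absNorm_span_half hsq hD1 hsd hadj hyw hη) (Ideal.subset_span (by simp)) hsqI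
    refine ⟨η / (8 * sd), div_ne_zero hη0 (by simpa using hsd0), ?_, Ideal.span {3, η},
      Ideal.isPrime_of_irreducible_absNorm (hP3 ▸ Nat.prime_three), hP3,
      (Ideal.span {η, 3 * (w : 𝓞 F)} : Ideal (𝓞 F)), ?_, ?_⟩
    · intro φ
      have hs : φ sd ^ 2 = D := by rw [← map_pow, hsd, map_intCast]
      have hφ : 2 * φ η = y + φ sd := by
        simpa [map_ofNat φ 2] using congrArg φ hη
      have hφ0 : φ sd ≠ 0 := by simpa using hsd0
      have hlt : (y : ℝ) ^ 2 < φ sd ^ 2 := by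
        rw [hs]
        have : 0 < w ^ 2 := by positivity
        exact_mod_cast (by omega : y ^ 2 < D)
      have : φ (η / (8 * sd)) = (y + φ sd) * φ sd / (16 * φ sd ^ 2) := by
        simp only [map_div₀, map_mul, map_ofNat]
        field_simp
        linear_combination 8 * hφ
      rw [this]
      apply div_pos
      · nlinarith [sq_nonneg ((y : ℝ) + φ sd)]
      · positivity
    · rw [FractionalIdeal.coeIdeal_ne_zero, Ne, Ideal.span_eq_bot]
      intro h0
      exact hη0 (by simpa using h0 η (by simp))
    · rw [coeIdeal_differentIdeal_eq_spanSingleton hsq hD1 hsd hadj hyw,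
        FractionalIdeal.spanSingleton_mul_spanSingleton, ← FractionalIdeal.coeIdeal_pow, hsqI,
        FractionalIdeal.coeIdeal_mul, FractionalIdeal.coeIdeal_span_singleton]
      congr 2
      field_simp
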